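/- Let V be a real inner product space and let u, v, q be unit vectors in V with q lying in the linear span of u and v. Then |⟪q, u⟫² + ⟪q, v⟫² − 1| ≤ |⟪u, v⟫|. In particular, if the angle between u and v deviates from π/2 by ξ (so that |⟪u, v⟫| = |sin ξ|), the objective cos²⟨q, u⟩ + cos²⟨q, v⟩ deviates from the constant value 1 by at most |sin ξ| (perturbed case of Theorem 1). -/

import Mathlib

open scoped RealInnerProductSpace

/-- Perturbed case of Theorem 1: for unit vectors `u`, `v`, and a unit
vector `q` in their span, the squared-cosine objective deviates from the
constant value `1` by at most `|⟪u, v⟫|` (which equals `|sin ξ|` when the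
angle between `u` and `v` is `π/2 ± ξ`). -/
theorem nearly_orthogonal_pair_bias
    {V : Type*} [NormedAddCommGroup V] [InnerProductSpace ℝ V]
    (u v q : V) (hu : ‖u‖ = 1) (hv : ‖v‖ = 1) (hq : ‖q‖ = 1)
    (hspan : q ∈ Submodule.span ℝ ({u, v} : Set V)) :
    |⟪q, u⟫ ^ 2 + ⟪q, v⟫ ^ 2 - 1| ≤ |⟪u, v⟫| := by
  obtain ⟨a, b, rfl⟩ := Submodule.mem_span_pair.mp hspan
  have hc : |⟪u, v⟫| ≤ 1 := by simpa [hu, hv] using abs_real_inner_le_norm u v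
  have hnorm : a ^ 2 + b ^ 2 + 2 * a * b * ⟪u, v⟫ = 1 := by
    have h := norm_add_sq_real (a • u) (b • v)
    simp only [hq, norm_smul, hu, hv, real_inner_smul_left, real_inner_smul_right,
      Real.norm_eq_abs, mul_one, sq_abs] at h
    linarith
  have hqu : ⟪a • u + b • v, u⟫ = a + b * ⟪u, v⟫ := by
    simp [inner_add_left, real_inner_smul_left, hu, real_inner_comm u v]
  have hqv : ⟪a • u + b • v, v⟫ = a * ⟪u, v⟫ + b := by
    simp [inner_add_left, real_inner_smul_left, hv]
  rw [hqu, hqv]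
  generalize ⟪u, v⟫ = c at *
  have hfactor : (a + b * c) ^ 2 + (a * c + b) ^ 2 - 1
      = c * (2 * a * b + (a ^ 2 + b ^ 2) * c) := by
    linear_combination hnorm
  rw [hfactor, abs_mul]
  refine mul_le_of_le_one_right (abs_nonneg c) ?_
  obtain ⟨hc₁, hc₂⟩ := abs_le.mp hc
  refine abs_le.mpr ⟨?_, ?_⟩
  · have h : 0 ≤ (a + b) ^ 2 * (1 + c) := mul_nonneg (sq_nonneg _) (by linarith)
    linarith
  · have h : 0 ≤ (a - b) ^ 2 * (1 - c) := mul_nonneg (sq_nonneg _) (by linarith)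
    linarith
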